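/- Let π : B → C be a surjective morphism of weak Hopf *-algebras such that C is linearly spanned by the π-images of matrix coefficients of right unitary corepresentations of B, let π_* : Ĉ → B̂ be the transpose of π, and let φ ∈ Ĉ. Then π(U_{π_*(φ)·ζ, η}) ∈ C_s for every right unitary corepresentation U of B on a finite-dimensional Hilbert space H and all η, ζ ∈ H (where B̂ acts on H by ψ·ζ := ⟨ψ, U^{(2)}⟩U^{(1)}ζ) if and only if φ is a left integral on C, i.e. (id ⊗ φ)Δ_C = (ε_t^C ⊗ φ)Δ_C. -/

import Mathlib

open scoped TensorProduct
open TensorProduct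

noncomputable section

/-- The conjugate-linear "star" operation on a tensor product of two star modules,
defined via a choice of bases so that `star (x ⊗ y) = star x ⊗ star y`. -/
def tensorStar (M N : Type) [AddCommGroup M] [Module ℂ M] [Module.Finite ℂ M]
    [Module.Free ℂ M] [StarAddMonoid M] [AddCommGroup N] [Module ℂ N] [Module.Finite ℂ N]
    [Module.Free ℂ N] [StarAddMonoid N] (t : M ⊗[ℂ] N) : M ⊗[ℂ] N :=
  let bM := Module.Free.chooseBasis ℂ M
  let bN := Module.Free.chooseBasis ℂ N
  ∑ p : Module.Free.ChooseBasisIndex ℂ M × Module.Free.ChooseBasisIndex ℂ N,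
    (starRingEnd ℂ) (((bM.tensorProduct bN).repr t) p) • (star (bM p.1) ⊗ₜ[ℂ] star (bN p.2))

/-- A weak Hopf `*`-algebra structure on a finite-dimensional `C*`-algebra `B`. -/
structure WHA (B : Type) [NormedRing B] [StarRing B] [CStarRing B] [NormedAlgebra ℂ B]
    [StarModule ℂ B] [FiniteDimensional ℂ B] where
  Δ : B →ₗ[ℂ] B ⊗[ℂ] B
  ε : B →ₗ[ℂ] ℂ
  S : B →ₗ[ℂ] B
  coassoc : ∀ b : B, (TensorProduct.assoc ℂ B B B) ((TensorProduct.map Δ LinearMap.id) (Δ b)) =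
    (TensorProduct.map LinearMap.id Δ) (Δ b)
  counit_left : ∀ b : B, (TensorProduct.lid ℂ B) ((TensorProduct.map ε LinearMap.id) (Δ b)) = b
  counit_right : ∀ b : B, (TensorProduct.rid ℂ B) ((TensorProduct.map LinearMap.id ε) (Δ b)) = b
  comul_mul : ∀ a b : B, Δ (a * b) = Δ a * Δ b
  weak_counit : ∀ b c d : B, (TensorProduct.lid ℂ ℂ)
      ((TensorProduct.map (ε ∘ₗ LinearMap.mulLeft ℂ b) (ε ∘ₗ LinearMap.mulRight ℂ d)) (Δ c)) =
    ε (b * c * d)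
  weak_comul_one : (TensorProduct.map Δ LinearMap.id) (Δ 1) =
    (Δ 1 ⊗ₜ[ℂ] (1 : B)) * ((TensorProduct.assoc ℂ B B B).symm ((1 : B) ⊗ₜ[ℂ] Δ 1))
  comul_star : ∀ b : B, Δ (star b) = tensorStar B B (Δ b)
  antipode_mul : ∀ a b : B, S (a * b) = S b * S a
  antipode_one : S 1 = 1
  antipode_comul : ∀ b : B, Δ (S b) =
    (TensorProduct.map S S) ((TensorProduct.comm ℂ B B) (Δ b))
  counit_antipode : ∀ b : B, ε (S b) = ε b
  antipode_left : ∀ b : B, LinearMap.mul' ℂ B ((TensorProduct.map LinearMap.id S) (Δ b)) =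
    (TensorProduct.lid ℂ B) ((TensorProduct.map ε LinearMap.id) (Δ 1 * (b ⊗ₜ[ℂ] (1 : B))))
  antipode_right : ∀ b : B, LinearMap.mul' ℂ B ((TensorProduct.map S LinearMap.id) (Δ b)) =
    (TensorProduct.rid ℂ B) ((TensorProduct.map LinearMap.id ε) (((1 : B) ⊗ₜ[ℂ] b) * Δ 1))

namespace WHA

variable {B : Type} [NormedRing B] [StarRing B] [CStarRing B] [NormedAlgebra ℂ B]
  [StarModule ℂ B] [FiniteDimensional ℂ B]

/-- The target counital map `ε_t(b) = (ε ⊗ id)(Δ(1)(b ⊗ 1))`. -/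
def εt (W : WHA B) (b : B) : B :=
  (TensorProduct.lid ℂ B) ((TensorProduct.map W.ε LinearMap.id) (W.Δ 1 * (b ⊗ₜ[ℂ] (1 : B))))

/-- The source counital map `ε_s(b) = (id ⊗ ε)((1 ⊗ b)Δ(1))`. -/
def εs (W : WHA B) (b : B) : B :=
  (TensorProduct.rid ℂ B) ((TensorProduct.map LinearMap.id W.ε) (((1 : B) ⊗ₜ[ℂ] b) * W.Δ 1))

/-- The target counital subalgebra `B_t = ε_t(B)`. -/
def Bt (W : WHA B) : Submodule ℂ B := Submodule.span ℂ (Set.range W.εt)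

/-- The source counital subalgebra `B_s = ε_s(B)`. -/
def Bs (W : WHA B) : Submodule ℂ B := Submodule.span ℂ (Set.range W.εs)

/-- The right adjoint action `b ◁ x = S(x₍₁₎) b x₍₂₎`. -/
def ad (W : WHA B) (b x : B) : B :=
  LinearMap.mul' ℂ B ((TensorProduct.map W.S (LinearMap.mulLeft ℂ b)) (W.Δ x))

/-- `I` is a (right) coideal of `B`: a unital `*`-subalgebra with `Δ(I) ⊆ I ⊗ B`. -/
def IsCoideal (W : WHA B) (I : Submodule ℂ B) : Prop :=
  (1 : B) ∈ I ∧ (∀ a ∈ I, ∀ b ∈ I, a * b ∈ I) ∧ (∀ a ∈ I, star a ∈ I) ∧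
    ∀ a ∈ I, W.Δ a ∈ Submodule.span ℂ {x : B ⊗[ℂ] B | ∃ u ∈ I, ∃ v : B, x = u ⊗ₜ[ℂ] v}

/-- A coideal is invariant if `span{ b ◁ x : b ∈ I, x ∈ B } = I`. -/
def IsInvariant (W : WHA B) (I : Submodule ℂ B) : Prop :=
  Submodule.span ℂ {y : B | ∃ b ∈ I, ∃ x : B, y = W.ad b x} = I

end WHA

/-- A morphism of weak Hopf `*`-algebras. -/
structure WHAHom {B C : Type} [NormedRing B] [StarRing B] [CStarRing B] [NormedAlgebra ℂ B]
    [StarModule ℂ B] [FiniteDimensional ℂ B] [NormedRing C] [StarRing C] [CStarRing C]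
    [NormedAlgebra ℂ C] [StarModule ℂ C] [FiniteDimensional ℂ C]
    (W : WHA B) (W' : WHA C) where
  π : B →⋆ₐ[ℂ] C
  comul_comp : ∀ b : B, W'.Δ (π b) = (TensorProduct.map π.toLinearMap π.toLinearMap) (W.Δ b)
  antipode_comp : ∀ b : B, W'.S (π b) = π (W.S b)
  counit_comp : ∀ b : B, W'.ε (π b) = W.ε b


/-- A right unitary corepresentation of a WHA on a finite-dimensional Hilbert space `H`:
a partial isometry `U ∈ B(H) ⊗ B` with `(id ⊗ Δ)(U) = U₁₂U₁₃` and `(id ⊗ ε)(U) = id`. -/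
structure UCorep {B : Type} [NormedRing B] [StarRing B] [CStarRing B] [NormedAlgebra ℂ B]
    [StarModule ℂ B] [FiniteDimensional ℂ B] (W : WHA B)
    (H : Type) [NormedAddCommGroup H] [InnerProductSpace ℂ H] [FiniteDimensional ℂ H] where
  U : (H →ₗ[ℂ] H) ⊗[ℂ] B
  partial_isometry : U * tensorStar (H →ₗ[ℂ] H) B U * U = U
  comul_eq : (TensorProduct.map LinearMap.id W.Δ) U =
    ((TensorProduct.map LinearMap.id ((TensorProduct.mk ℂ B B).flip 1)) U) *
      ((TensorProduct.map LinearMap.id (TensorProduct.mk ℂ B B 1)) U)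
  counit_eq : (TensorProduct.rid ℂ (H →ₗ[ℂ] H)) ((TensorProduct.map LinearMap.id W.ε) U) =
    LinearMap.id

namespace UCorep

variable {B : Type} [NormedRing B] [StarRing B] [CStarRing B] [NormedAlgebra ℂ B]
  [StarModule ℂ B] [FiniteDimensional ℂ B] {W : WHA B}
  {H : Type} [NormedAddCommGroup H] [InnerProductSpace ℂ H] [FiniteDimensional ℂ H]

/-- The matrix coefficient `U_{η,ζ} = ⟨U⁽¹⁾ζ, η⟩ U⁽²⁾ ∈ B` of a unitary corepresentation. -/
def matCoef (V : UCorep W H) (η ζ : H) : B :=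
  (TensorProduct.lid ℂ B)
    ((TensorProduct.map ((innerSL ℂ η).toLinearMap ∘ₗ LinearMap.applyₗ (R := ℂ) ζ)
      LinearMap.id) V.U)

/-- The left action of the dual `B̂` on `H`: `φ · ζ = ⟨φ, U⁽²⁾⟩ U⁽¹⁾ ζ`. -/
def dualAct (V : UCorep W H) (φ : Module.Dual ℂ B) (ζ : H) : H :=
  ((TensorProduct.rid ℂ (H →ₗ[ℂ] H)) ((TensorProduct.map LinearMap.id φ) V.U)) ζ

end UCorep


/-- The target counital map as a linear map. -/
def WHA.εtL {B : Type} [NormedRing B] [StarRing B] [CStarRing B] [NormedAlgebra ℂ B]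
    [StarModule ℂ B] [FiniteDimensional ℂ B] (W : WHA B) : B →ₗ[ℂ] B :=
  (TensorProduct.lid ℂ B).toLinearMap ∘ₗ TensorProduct.map W.ε LinearMap.id ∘ₗ
    LinearMap.mulLeft ℂ (W.Δ 1) ∘ₗ (TensorProduct.mk ℂ B B).flip 1

/-- `φ ∈ Ĉ` is a left integral: `(id ⊗ φ)Δ = (ε_t ⊗ φ)Δ`. -/
def IsLeftIntegral {C : Type} [NormedRing C] [StarRing C] [CStarRing C] [NormedAlgebra ℂ C]
    [StarModule ℂ C] [FiniteDimensional ℂ C] (W' : WHA C) (φ : Module.Dual ℂ C) : Prop :=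
  ∀ c : C, (TensorProduct.rid ℂ C) ((TensorProduct.map LinearMap.id φ) (W'.Δ c)) =
    (TensorProduct.rid ℂ C) ((TensorProduct.map W'.εtL φ) (W'.Δ c))

open scoped ComplexOrder in
lemma exists_faithful_positive_functional (B : Type) [NormedRing B] [StarRing B] [CStarRing B]
    [NormedAlgebra ℂ B] [StarModule ℂ B] [FiniteDimensional ℂ B] :
    ∃ τ : B →ₗ[ℂ] ℂ, (∀ b, 0 ≤ τ (star b * b)) ∧ ∀ b, τ (star b * b) = 0 → b = 0 := by
  have : CompleteSpace B := FiniteDimensional.complete ℂ B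
  let _ : CStarAlgebra B := { (inferInstance : NormedRing B), (inferInstance : StarRing B),
    (inferInstance : NormedAlgebra ℂ B) with
    complete := CompleteSpace.complete
    norm_mul_self_le := CStarRing.norm_mul_self_le
    star_smul := star_smul }
  have hroot : ∀ (b : B) (μ : ℂ), μ ∈ (LinearMap.charpoly (LinearMap.mulLeft ℂ b)).roots →
      μ ∈ spectrum ℂ b := by
    intro b μ hμ
    have h1 := (Module.End.mem_spectrum_iff_isRoot_charpoly _ _).2 (Polynomial.isRoot_of_mem_roots hμ)
    exact AlgHom.spectrum_apply_subset (Algebra.lmul ℂ B) b h1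
  have hnn : ∀ (b : B) (μ : ℂ), μ ∈ (LinearMap.charpoly (LinearMap.mulLeft ℂ (star b * b))).roots →
      0 ≤ μ := by
    intro b μ hμ
    have h1 := hroot _ _ hμ
    have h2 : IsSelfAdjoint (star b * b) := IsSelfAdjoint.star_mul_self b
    have h3 := h2.mem_spectrum_eq_re h1
    rw [h3] at h1 ⊢
    have h4 : μ.re ∈ spectrum ℝ (star b * b) := spectrum.of_algebraMap_mem ℂ h1
    exact Complex.zero_le_real.2 (spectrum_star_mul_self_nonneg _ h4)
  have htr : ∀ b : B, LinearMap.trace ℂ B (LinearMap.mulLeft ℂ b) =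
      (LinearMap.charpoly (LinearMap.mulLeft ℂ b)).roots.sum := fun b =>
    Module.End.trace_eq_sum_roots_charpoly_of_splits (IsAlgClosed.splits _)
  refine ⟨LinearMap.trace ℂ B ∘ₗ (LinearMap.mul ℂ B), fun b => ?_, fun b hb => ?_⟩
  · change 0 ≤ LinearMap.trace ℂ B (LinearMap.mulLeft ℂ (star b * b))
    rw [htr]
    exact Multiset.sum_nonneg (hnn b)
  · change LinearMap.trace ℂ B (LinearMap.mulLeft ℂ (star b * b)) = 0 at hb
    rw [htr] at hb
    have h0 := (Multiset.all_zero_of_le_zero_le_of_sum_eq_zero (hnn b) hb)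
    have hspec : ∀ μ ∈ spectrum ℂ (star b * b), μ = 0 := by
      intro μ hμ
      apply h0
      rw [Polynomial.mem_roots (LinearMap.charpoly_monic _).ne_zero,
        ← Module.End.mem_spectrum_iff_isRoot_charpoly]
      intro hu
      apply hμ
      have h5 : ∃ y : B, LinearMap.mulLeft ℂ (algebraMap ℂ B μ - star b * b) y = 1 := by
        have h6 := ((Module.End.isUnit_iff _).1 hu).2 1
        obtain ⟨y, hy⟩ := h6
        refine ⟨y, ?_⟩
        simpa [sub_mul, Algebra.algebraMap_eq_smul_one, mul_assoc] using hy
      obtain ⟨y, hy⟩ := h5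
      have : IsArtinianRing B := IsArtinianRing.of_finite ℂ B
      exact IsUnit.of_mul_eq_one _ hy
    have h2 : IsSelfAdjoint (star b * b) := IsSelfAdjoint.star_mul_self b
    have h7 : spectralRadius ℂ (star b * b) = 0 := by
      simp only [spectralRadius, ENNReal.iSup_eq_zero]
      intro μ hμ
      simp [hspec μ hμ]
    rw [h2.spectralRadius_eq_nnnorm] at h7
    have h8 : star b * b = 0 := by simpa using h7
    exact CStarRing.star_mul_self_eq_zero_iff b |>.1 h8

lemma tensorStar_eq_star (M N : Type) [AddCommGroup M] [Module ℂ M] [Module.Finite ℂ M]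
    [Module.Free ℂ M] [StarAddMonoid M] [StarModule ℂ M] [AddCommGroup N] [Module ℂ N]
    [Module.Finite ℂ N] [Module.Free ℂ N] [StarAddMonoid N] [StarModule ℂ N] (t : M ⊗[ℂ] N) :
    tensorStar M N t = star t := by
  conv_rhs => rw [← ((Module.Free.chooseBasis ℂ M).tensorProduct
    (Module.Free.chooseBasis ℂ N)).sum_repr t]
  simp only [tensorStar, star_sum, star_smul, Module.Basis.tensorProduct_apply', star_tmul]
  rfl

namespace WHA

variable {B : Type} [NormedRing B] [StarRing B] [CStarRing B] [NormedAlgebra ℂ B]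
  [StarModule ℂ B] [FiniteDimensional ℂ B] (W : WHA B)

/-- The source counital map as a linear map. -/
def εsL : B →ₗ[ℂ] B :=
  (TensorProduct.rid ℂ B).toLinearMap ∘ₗ TensorProduct.map LinearMap.id W.ε ∘ₗ
    LinearMap.mulRight ℂ (W.Δ 1) ∘ₗ TensorProduct.mk ℂ B B 1

@[simp] lemma εsL_apply (b : B) : W.εsL b = W.εs b := rfl

@[simp] lemma εtL_apply (b : B) : W.εtL b = W.εt b := rfl

lemma comul_star_eq (b : B) : W.Δ (star b) = star (W.Δ b) := by
  rw [W.comul_star, tensorStar_eq_star]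

lemma comul_one_mul (b : B) : W.Δ 1 * W.Δ b = W.Δ b := by rw [← W.comul_mul, one_mul]

lemma comul_mul_one (b : B) : W.Δ b * W.Δ 1 = W.Δ b := by rw [← W.comul_mul, mul_one]

lemma star_map_comul (t : B ⊗[ℂ] B) :
    star (TensorProduct.map W.Δ LinearMap.id t) = TensorProduct.map W.Δ LinearMap.id (star t) := by
  induction t with
  | zero => simp
  | tmul x y => simp [comul_star_eq]
  | add x y hx hy => simp only [map_add, star_add, hx, hy]

/-- The weak comultiplicativity of the unit with the two factors interchanged. -/
lemma weak_comul_one' : (TensorProduct.map W.Δ LinearMap.id) (W.Δ 1) =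
    ((TensorProduct.assoc ℂ B B B).symm ((1 : B) ⊗ₜ[ℂ] W.Δ 1)) * (W.Δ 1 ⊗ₜ[ℂ] (1 : B)) := by
  have hs : star (W.Δ 1) = W.Δ 1 := by rw [← comul_star_eq, star_one]
  have ha : ∀ t : B ⊗[ℂ] B, star ((TensorProduct.assoc ℂ B B B).symm ((1 : B) ⊗ₜ[ℂ] t)) =
      (TensorProduct.assoc ℂ B B B).symm ((1 : B) ⊗ₜ[ℂ] star t) := by
    intro t
    induction t with
    | zero => simp
    | tmul x y => simp
    | add x y hx hy => simp only [tmul_add, map_add, star_add, hx, hy]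
  have h := congrArg star W.weak_comul_one
  rwa [star_map_comul, star_mul, hs, ha, star_tmul, star_one, hs] at h

lemma εt_eq_sum {ι : Type} [Fintype ι] {x y : ι → B} (h : W.Δ 1 = ∑ i, x i ⊗ₜ[ℂ] y i) (b : B) :
    W.εt b = ∑ i, W.ε (x i * b) • y i := by
  simp [εt, h, Finset.sum_mul]

lemma εs_eq_sum {ι : Type} [Fintype ι] {x y : ι → B} (h : W.Δ 1 = ∑ i, x i ⊗ₜ[ℂ] y i) (b : B) :
    W.εs b = ∑ i, W.ε (b * y i) • x i := by
  simp [εs, h, Finset.mul_sum]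

lemma εt_one : W.εt 1 = 1 := by
  have := W.counit_left 1
  simpa [εt, ← Algebra.TensorProduct.one_def] using this

lemma εs_one : W.εs 1 = 1 := by
  have := W.counit_right 1
  simpa [εs, ← Algebra.TensorProduct.one_def] using this

lemma comul_εs (b : B) : W.Δ (W.εs b) = ((1 : B) ⊗ₜ[ℂ] W.εs b) * W.Δ 1 := by
  obtain ⟨n, x, y, h⟩ := TensorProduct.exists_sum_tmul_eq (W.Δ 1)
  have h1 := congrArg (fun t => (TensorProduct.rid ℂ (B ⊗[ℂ] B)) (TensorProduct.map LinearMap.id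
    (W.ε ∘ₗ LinearMap.mulLeft ℂ b) t)) W.weak_comul_one'
  simp only [h, map_sum, tmul_sum, sum_tmul, Finset.mul_sum, Finset.sum_mul] at h1
  simp only [map_tmul, assoc_symm_tmul, Algebra.TensorProduct.tmul_mul_tmul, one_mul, mul_one,
    LinearMap.id_apply, LinearMap.comp_apply, LinearMap.mulLeft_apply, rid_tmul] at h1
  rw [W.εs_eq_sum h, map_sum, h]
  simp only [map_smul, h1, tmul_sum, Finset.sum_mul, Finset.mul_sum]
  simp

lemma comul_εs' (b : B) : W.Δ (W.εs b) = W.Δ 1 * ((1 : B) ⊗ₜ[ℂ] W.εs b) := by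
  obtain ⟨n, x, y, h⟩ := TensorProduct.exists_sum_tmul_eq (W.Δ 1)
  have h1 := congrArg (fun t => (TensorProduct.rid ℂ (B ⊗[ℂ] B)) (TensorProduct.map LinearMap.id
    (W.ε ∘ₗ LinearMap.mulLeft ℂ b) t)) W.weak_comul_one
  simp only [h, map_sum, tmul_sum, sum_tmul, Finset.mul_sum, Finset.sum_mul] at h1
  simp only [map_tmul, assoc_symm_tmul, Algebra.TensorProduct.tmul_mul_tmul, one_mul, mul_one,
    LinearMap.id_apply, LinearMap.comp_apply, LinearMap.mulLeft_apply, rid_tmul] at h1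
  rw [W.εs_eq_sum h, map_sum, h]
  simp only [map_smul, h1, tmul_sum, Finset.sum_mul, Finset.mul_sum]
  simp

lemma comul_εt (b : B) : W.Δ (W.εt b) = W.Δ 1 * (W.εt b ⊗ₜ[ℂ] (1 : B)) := by
  obtain ⟨n, x, y, h⟩ := TensorProduct.exists_sum_tmul_eq (W.Δ 1)
  have h1 := congrArg (fun t => (TensorProduct.lid ℂ (B ⊗[ℂ] B)) (TensorProduct.map
    (W.ε ∘ₗ LinearMap.mulRight ℂ b) LinearMap.id (TensorProduct.assoc ℂ B B B t))) W.weak_comul_one'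
  simp only [W.coassoc] at h1
  simp only [h, map_sum, tmul_sum, sum_tmul, Finset.mul_sum, Finset.sum_mul] at h1
  simp only [map_tmul, assoc_symm_tmul, assoc_tmul, Algebra.TensorProduct.tmul_mul_tmul, one_mul,
    mul_one, LinearMap.id_apply, LinearMap.comp_apply, LinearMap.mulRight_apply, lid_tmul] at h1
  rw [W.εt_eq_sum h, map_sum, h]
  simp only [map_smul, h1, sum_tmul, Finset.sum_mul, Finset.mul_sum]
  simp [smul_tmul', Algebra.TensorProduct.tmul_mul_tmul]

/-- `ε_s(b₍₁₎) ⊗ b₍₂₎ = 1₍₁₎ ⊗ b 1₍₂₎`. -/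
lemma map_εs_comul (b : B) :
    TensorProduct.map W.εsL LinearMap.id (W.Δ b) = ((1 : B) ⊗ₜ[ℂ] b) * W.Δ 1 := by
  obtain ⟨n, x, y, h⟩ := TensorProduct.exists_sum_tmul_eq (W.Δ 1)
  let G : B ⊗[ℂ] (B ⊗[ℂ] B) →ₗ[ℂ] B ⊗[ℂ] B := TensorProduct.map LinearMap.id
    ((TensorProduct.lid ℂ B).toLinearMap ∘ₗ TensorProduct.map W.ε LinearMap.id ∘ₗ
      LinearMap.mulLeft ℂ (W.Δ b))
  have h1 := congrArg (fun t => G (TensorProduct.assoc ℂ B B B t)) W.weak_comul_one'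
  simp only [W.coassoc] at h1
  have hL : G (TensorProduct.map LinearMap.id W.Δ (W.Δ 1)) = ((1 : B) ⊗ₜ[ℂ] b) * W.Δ 1 := by
    simp only [G, h, map_sum, map_tmul, LinearMap.comp_apply, LinearMap.mulLeft_apply,
      ← W.comul_mul, Finset.mul_sum, LinearEquiv.coe_coe, W.counit_left,
      Algebra.TensorProduct.tmul_mul_tmul, one_mul, LinearMap.id_apply]
  have hc : ∀ i, ∑ j, (x i) ⊗ₜ[ℂ] ((x j * y i) ⊗ₜ[ℂ] (y j)) =
      (x i) ⊗ₜ[ℂ] (W.Δ 1 * (y i ⊗ₜ[ℂ] (1 : B))) := by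
    intro i
    rw [h, Finset.sum_mul, tmul_sum]
    simp
  have hR : TensorProduct.assoc ℂ B B B (((TensorProduct.assoc ℂ B B B).symm
      ((1 : B) ⊗ₜ[ℂ] W.Δ 1)) * (W.Δ 1 ⊗ₜ[ℂ] (1 : B))) =
      ∑ i, (x i) ⊗ₜ[ℂ] (W.Δ 1 * (y i ⊗ₜ[ℂ] (1 : B))) := by
    simp only [← hc]
    simp only [h, map_sum, tmul_sum, sum_tmul, Finset.mul_sum, Finset.sum_mul]
    simp
  rw [hL, hR, map_sum] at h1
  rw [h1]
  have hG : ∀ i, G ((x i) ⊗ₜ[ℂ] (W.Δ 1 * (y i ⊗ₜ[ℂ] (1 : B)))) = x i ⊗ₜ[ℂ]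
      (TensorProduct.lid ℂ B (TensorProduct.map W.ε LinearMap.id
        (W.Δ b * (y i ⊗ₜ[ℂ] (1 : B))))) := by
    intro i
    simp only [G, map_tmul, LinearMap.comp_apply, LinearMap.mulLeft_apply, ← mul_assoc,
      W.comul_mul_one, LinearMap.id_apply, LinearEquiv.coe_coe]
  simp only [hG]
  induction W.Δ b with
  | zero => simp
  | tmul p q => simp [W.εs_eq_sum h, sum_tmul, smul_tmul]
  | add p q hp hq => simp only [add_mul, map_add, tmul_add, Finset.sum_add_distrib, hp, hq]

lemma counit_εs (b : B) : W.ε (W.εs b) = W.ε b := by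
  obtain ⟨n, x, y, h⟩ := TensorProduct.exists_sum_tmul_eq (W.Δ 1)
  have h1 := congrArg (fun t => W.ε (b * t)) (W.counit_left 1)
  rw [W.εs_eq_sum h]
  simpa [h, mul_comm, Finset.mul_sum] using h1

lemma mul_antipode_left_eq (b : B) :
    LinearMap.mul' ℂ B (TensorProduct.map LinearMap.id W.S (W.Δ b)) = W.εt b := W.antipode_left b

lemma mul_antipode_right_eq (b : B) :
    LinearMap.mul' ℂ B (TensorProduct.map W.S LinearMap.id (W.Δ b)) = W.εs b := W.antipode_right b

/-- `ε_t(b₍₁₎) b₍₂₎ = b`. -/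
lemma mul_map_εt_comul (b : B) :
    LinearMap.mul' ℂ B (TensorProduct.map W.εtL LinearMap.id (W.Δ b)) = b := by
  have h1 := W.counit_left b
  rw [← W.comul_one_mul] at h1
  obtain ⟨n, x, y, h⟩ := TensorProduct.exists_sum_tmul_eq (W.Δ 1)
  conv_rhs => rw [← h1]
  induction W.Δ b with
  | zero => simp
  | tmul p q => simp [h, W.εt_eq_sum h, Finset.sum_mul]
  | add p q hp hq => simp only [mul_add, map_add, hp, hq]

/-- `ε_s(b₍₁₎) S(b₍₂₎) = S(b)`. -/
lemma mul_map_εs_antipode_comul (b : B) :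
    LinearMap.mul' ℂ B (TensorProduct.map W.εsL W.S (W.Δ b)) = W.S b := by
  have h1 : TensorProduct.map W.εsL W.S (W.Δ b) =
      TensorProduct.map LinearMap.id W.S (TensorProduct.map W.εsL LinearMap.id (W.Δ b)) := by
    rw [TensorProduct.map_map]; rfl
  have h2 := W.mul_antipode_left_eq 1
  rw [εt_one] at h2
  rw [h1, map_εs_comul]
  conv_rhs => rw [← one_mul (W.S b), ← h2]
  induction W.Δ 1 with
  | zero => simp
  | tmul p q => simp [W.antipode_mul, mul_assoc]
  | add p q hp hq => simp only [mul_add, add_mul, map_add, hp, hq]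

lemma εs_εs (b : B) : W.εs (W.εs b) = W.εs b := by
  have h2 := W.mul_antipode_right_eq 1
  rw [εs_one] at h2
  rw [← W.mul_antipode_right_eq, comul_εs']
  conv_rhs => rw [← one_mul (W.εs b), ← h2]
  induction W.Δ 1 with
  | zero => simp
  | tmul p q => simp [mul_assoc]
  | add p q hp hq => simp only [add_mul, map_add, hp, hq]

lemma antipode_εt (b : B) : W.S (W.εt b) = W.εs (W.S b) := by
  rw [← W.mul_antipode_right_eq, ← W.mul_antipode_left_eq, W.antipode_comul]
  induction W.Δ b with
  | zero => simp
  | tmul p q => simp [W.antipode_mul]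
  | add p q hp hq => simp only [map_add, hp, hq]

lemma antipode_εs (b : B) : W.S (W.εs b) = W.εt (W.S b) := by
  rw [← W.mul_antipode_right_eq, ← W.mul_antipode_left_eq, W.antipode_comul]
  induction W.Δ b with
  | zero => simp
  | tmul p q => simp [W.antipode_mul]
  | add p q hp hq => simp only [map_add, hp, hq]

lemma mem_Bs_iff (b : B) : b ∈ W.Bs ↔ W.εs b = b := by
  constructor
  · intro hb
    have hle : W.Bs ≤ LinearMap.eqLocus W.εsL LinearMap.id :=
      Submodule.span_le.2 (by rintro _ ⟨c, rfl⟩; exact W.εs_εs c)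
    exact hle hb
  · intro hb
    exact Submodule.subset_span ⟨b, hb⟩

end WHA

open scoped ComplexOrder in
lemma map_star_of_nonneg {B : Type} [NormedRing B] [StarRing B] [NormedAlgebra ℂ B]
    [StarModule ℂ B] (τ : B →ₗ[ℂ] ℂ) (hτ : ∀ b, 0 ≤ τ (star b * b)) (b : B) :
    τ (star b) = star (τ b) := by
  have him : ∀ c, (τ (star c * c)).im = 0 := fun c => (Complex.nonneg_iff.1 (hτ c)).2.symm
  have h1 := him (1 + b)
  have h2 := him (1 + Complex.I • b)
  have h3 := him b
  have h4 := him 1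
  simp [add_mul, mul_add, star_smul] at h1 h2 h3 h4
  apply Complex.ext <;> simp <;> linarith

section Positivity

variable {B : Type} [NormedRing B] [StarRing B] [CStarRing B] [NormedAlgebra ℂ B]
  [StarModule ℂ B] [FiniteDimensional ℂ B]

open scoped ComplexOrder in
lemma eq_zero_of_sum_star_mul_self_eq_zero {ι : Type} [Fintype ι] (x : ι → B)
    (h : ∑ a, star (x a) * x a = 0) (a : ι) : x a = 0 := by
  obtain ⟨τ, hpos, hfaith⟩ := exists_faithful_positive_functional B
  have h1 := congrArg τ h
  rw [map_sum, map_zero, Finset.sum_eq_zero_iff_of_nonneg (fun i _ => hpos (x i))] at h1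
  exact hfaith _ (h1 a (Finset.mem_univ a))

open scoped ComplexOrder MatrixOrder in
lemma eq_zero_of_sum_tmul_star_mul_eq_zero {n : ℕ} (z u : Matrix (Fin n) (Fin n) B)
    (hsep : ∀ c : Fin n → ℂ, (∀ i, ∑ k, c k • u k i = 0) → c = 0)
    (h : ∀ i, ∑ k, ∑ l, (z.conjTranspose * z) k l ⊗ₜ[ℂ] (star (u k i) * u l i) = 0) : z = 0 := by
  obtain ⟨τ, hpos, hfaith⟩ := exists_faithful_positive_functional B
  let Y : Matrix (Fin n) (Fin n) ℂ := (z.conjTranspose * z).map τ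
  have hsum : ∀ c : Fin n → ℂ, star c ⬝ᵥ (Y.mulVec c) =
      ∑ m, τ (star (∑ k, c k • z m k) * ∑ k, c k • z m k) := by
    intro c
    simp only [Y, dotProduct, Matrix.mulVec, Matrix.map_apply, Matrix.mul_apply,
      Matrix.conjTranspose_apply, star_sum, star_smul, Finset.sum_mul, Finset.mul_sum, map_sum,
      smul_mul_smul_comm, map_smul, Pi.star_apply, smul_eq_mul]
    rw [Finset.sum_comm_cycle]
    refine Finset.sum_congr rfl fun m _ => Finset.sum_comm.trans ?_
    refine Finset.sum_congr rfl fun k _ => Finset.sum_congr rfl fun l _ => ?_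
    ring
  have hnn : ∀ c : Fin n → ℂ, 0 ≤ star c ⬝ᵥ (Y.mulVec c) := by
    intro c
    rw [hsum]
    exact Finset.sum_nonneg fun m _ => hpos _
  have hY : Y.PosSemidef := by
    refine .of_dotProduct_mulVec_nonneg (Matrix.IsHermitian.ext fun k l => ?_) hnn
    simp only [Y, Matrix.map_apply]
    rw [← map_star_of_nonneg τ hpos, ← Matrix.conjTranspose_apply, Matrix.conjTranspose_mul,
      Matrix.conjTranspose_conjTranspose]
  obtain ⟨Z, hZs, -, hZ⟩ := CFC.exists_sqrt_of_isSelfAdjoint_of_quasispectrumRestricts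
    hY.isHermitian (QuasispectrumRestricts.nnreal_of_nonneg hY.nonneg)
  replace hZ : Y = star Z * Z := by rw [hZs.star_eq, hZ]
  have hZ0 : Z = 0 := by
    ext a i
    refine congrFun (hsep (Z a) fun i => ?_) i
    refine eq_zero_of_sum_star_mul_self_eq_zero (fun a => ∑ k, Z a k • u k i) ?_ a
    have h1 := congrArg (fun t => TensorProduct.lid ℂ B (TensorProduct.map τ LinearMap.id t)) (h i)
    simp only [map_sum, map_tmul, lid_tmul, LinearMap.id_apply, map_zero] at h1
    rw [← h1]
    have h2 : ∀ k l, τ ((z.conjTranspose * z) k l) = ∑ a, star (Z a k) * Z a l := by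
      intro k l
      exact congrFun (congrFun hZ k) l
    simp only [h2, star_sum, star_smul, Finset.sum_mul, Finset.mul_sum, Finset.sum_smul,
      smul_mul_smul_comm]
    rw [Finset.sum_comm_cycle]
    refine Finset.sum_congr rfl fun m _ => Finset.sum_comm
  ext m i
  have h3 : ∑ m, τ (star (z m i) * z m i) = 0 := by
    have : Y i i = 0 := by rw [hZ, hZ0]; simp
    simpa [Y, Matrix.mul_apply] using this
  rw [Finset.sum_eq_zero_iff_of_nonneg (fun m _ => hpos _)] at h3
  exact hfaith _ (h3 m (Finset.mem_univ m))

end Positivity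

namespace WHA

open Matrix

variable {B : Type} [NormedRing B] [StarRing B] [CStarRing B] [NormedAlgebra ℂ B]
  [StarModule ℂ B] [FiniteDimensional ℂ B] (W : WHA B) {n : ℕ} {u : Matrix (Fin n) (Fin n) B}

/-- The scalar matrix `ε(x)`, viewed as a matrix over `B`. -/
def counitMatrix (x : Matrix (Fin n) (Fin n) B) : Matrix (Fin n) (Fin n) B :=
  (x.map W.ε).map (algebraMap ℂ B)

lemma mul_map_antipode (hΔ : ∀ i j, W.Δ (u i j) = ∑ k, u i k ⊗ₜ[ℂ] u k j) :
    u * u.map W.S = u.map W.εt := by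
  ext i j
  simp [Matrix.mul_apply, ← W.mul_antipode_left_eq, hΔ]

lemma map_antipode_mul (hΔ : ∀ i j, W.Δ (u i j) = ∑ k, u i k ⊗ₜ[ℂ] u k j) :
    u.map W.S * u = u.map W.εs := by
  ext i j
  simp [Matrix.mul_apply, ← W.mul_antipode_right_eq, hΔ]

lemma map_εt_mul (hΔ : ∀ i j, W.Δ (u i j) = ∑ k, u i k ⊗ₜ[ℂ] u k j) :
    u.map W.εt * u = u := by
  ext i j
  conv_rhs => rw [← W.mul_map_εt_comul (u i j)]
  simp [Matrix.mul_apply, hΔ]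

lemma map_εs_mul_map_antipode (hΔ : ∀ i j, W.Δ (u i j) = ∑ k, u i k ⊗ₜ[ℂ] u k j) :
    u.map W.εs * u.map W.S = u.map W.S := by
  ext i j
  rw [Matrix.map_apply, ← W.mul_map_εs_antipode_comul (u i j)]
  simp [Matrix.mul_apply, hΔ]

lemma comul_star_coef (hΔ : ∀ i j, W.Δ (u i j) = ∑ k, u i k ⊗ₜ[ℂ] u k j) (i j : Fin n) :
    W.Δ (star (u i j)) = ∑ k, star (u i k) ⊗ₜ[ℂ] star (u k j) := by
  simp [comul_star_eq, hΔ]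

lemma map_εs_mul_conjTranspose (hΔ : ∀ i j, W.Δ (u i j) = ∑ k, u i k ⊗ₜ[ℂ] u k j) :
    u.map W.εs * uᴴ = W.counitMatrix (u.map W.εs * uᴴ) * uᴴ := by
  have hc : ∀ i j, W.Δ ((u.map W.εs * uᴴ) i j) =
      ∑ l, star (u j l) ⊗ₜ[ℂ] (u.map W.εs * uᴴ) i l := by
    intro i j
    have : ∀ k, W.Δ (W.εs (u i k) * star (u j k)) =
        ∑ l, star (u j l) ⊗ₜ[ℂ] (W.εs (u i k) * star (u l k)) := by
      intro k
      rw [W.comul_mul, comul_εs, mul_assoc, comul_one_mul, W.comul_star_coef hΔ]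
      simp [Finset.mul_sum]
    simp only [Matrix.mul_apply, Matrix.map_apply, conjTranspose_apply, map_sum, this, tmul_sum]
    exact Finset.sum_comm
  ext i j
  conv_lhs => rw [← W.counit_right ((u.map W.εs * uᴴ) i j), hc]
  simp only [map_sum, map_tmul, rid_tmul, LinearMap.id_apply]
  conv_rhs => rw [Matrix.mul_apply]
  simp [counitMatrix, Algebra.smul_def]

lemma exists_conjTranspose_mul_eq (hΔ : ∀ i j, W.Δ (u i j) = ∑ k, u i k ⊗ₜ[ℂ] u k j)
    (hε : ∀ i j, W.ε (u i j) = (1 : Matrix (Fin n) (Fin n) ℂ) i j) (hu : u * uᴴ * u = u) :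
    ∃ T : Matrix (Fin n) (Fin n) ℂ, uᴴ * u = T.map (algebraMap ℂ B) * u.map W.εs := by
  have hf : u.map W.εs = W.counitMatrix (u.map W.εs * uᴴ) * (uᴴ * u) := by
    rw [← Matrix.mul_assoc, ← W.map_εs_mul_conjTranspose hΔ, ← W.map_antipode_mul hΔ,
      Matrix.mul_assoc, Matrix.mul_assoc, ← Matrix.mul_assoc u, hu]
  have hinv : (u.map W.εs * uᴴ).map W.ε * (uᴴ * u).map W.ε = 1 := by
    ext i j
    have h1 := congrArg W.ε (congrFun (congrFun hf i) j)
    rw [Matrix.map_apply, counit_εs, hε] at h1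
    rw [h1, Matrix.mul_apply, Matrix.mul_apply, map_sum]
    simp [counitMatrix, ← Algebra.smul_def]
  refine ⟨(uᴴ * u).map W.ε, ?_⟩
  rw [mul_eq_one_comm] at hinv
  conv_rhs => rw [hf, counitMatrix, ← Matrix.mul_assoc, ← Matrix.map_mul, hinv]
  simp

lemma conjTranspose_mul_eq_map_εs (hΔ : ∀ i j, W.Δ (u i j) = ∑ k, u i k ⊗ₜ[ℂ] u k j)
    (hε : ∀ i j, W.ε (u i j) = (1 : Matrix (Fin n) (Fin n) ℂ) i j) (hu : u * uᴴ * u = u) :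
    uᴴ * u = u.map W.εs := by
  obtain ⟨T, hT⟩ := W.exists_conjTranspose_mul_eq hΔ hε hu
  set f := u.map W.εs with hf
  have hΔq : ∀ i j, W.Δ ((uᴴ * u) i j) = ((1 : B) ⊗ₜ[ℂ] (uᴴ * u) i j) * W.Δ 1 := by
    intro i j
    rw [hT]
    simp only [Matrix.mul_apply, Matrix.map_apply, ← Algebra.smul_def, map_sum, map_smul, hf,
      comul_εs, tmul_sum, tmul_smul, Finset.sum_mul, smul_mul_assoc]
  have hqf : uᴴ * u * f = uᴴ * u := by
    rw [hf, ← W.map_antipode_mul hΔ, Matrix.mul_assoc, ← Matrix.mul_assoc u,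
      W.mul_map_antipode hΔ, W.map_εt_mul hΔ]
  have hqq : uᴴ * u * (uᴴ * u) = uᴴ * u := by
    rw [Matrix.mul_assoc, ← Matrix.mul_assoc u, hu]
  have hqs : (uᴴ * u)ᴴ = uᴴ * u := by simp
  have hfq : fᴴ * (uᴴ * u) = uᴴ * u := by
    rw [← hqs, ← conjTranspose_mul, hqs, hqf, hqs]
  have hz : (f - uᴴ * u)ᴴ * (f - uᴴ * u) = fᴴ * f - uᴴ * u := by
    rw [conjTranspose_sub, sub_mul, mul_sub, mul_sub, hfq, hqs, hqf, hqq]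
    abel
  have hw : ∀ m i, ∑ k, f m k ⊗ₜ[ℂ] u k i = ((1 : B) ⊗ₜ[ℂ] u m i) * W.Δ 1 := by
    intro m i
    rw [← W.map_εs_comul, hΔ]
    simp [hf]
  have hsum : ∀ (g : Matrix (Fin n) (Fin n) B) (i : Fin n),
      ∑ k, ∑ l, (gᴴ * g) k l ⊗ₜ[ℂ] (star (u k i) * u l i) =
        ∑ m, star (∑ k, g m k ⊗ₜ[ℂ] u k i) * ∑ k, g m k ⊗ₜ[ℂ] u k i := by
    intro g i
    simp only [Matrix.mul_apply, conjTranspose_apply, star_sum, Finset.sum_mul, Finset.mul_sum,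
      sum_tmul, star_tmul, Algebra.TensorProduct.tmul_mul_tmul]
    rw [Finset.sum_comm_cycle]
    exact Finset.sum_congr rfl fun m _ => Finset.sum_comm
  have h1 : ∀ i, ∑ k, ∑ l, (fᴴ * f) k l ⊗ₜ[ℂ] (star (u k i) * u l i) = W.Δ ((uᴴ * u) i i) := by
    intro i
    have hs : star (W.Δ 1) = W.Δ 1 := by rw [← comul_star_eq, star_one]
    rw [hsum, ← comul_one_mul, hΔq]
    simp only [hw, star_mul, star_tmul, star_one, hs, Matrix.mul_apply, conjTranspose_apply,
      tmul_sum, Finset.sum_mul, Finset.mul_sum]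
    refine Finset.sum_congr rfl fun m _ => ?_
    rw [mul_assoc, ← mul_assoc ((1 : B) ⊗ₜ[ℂ] star (u m i))]
    simp
  have h2 : ∀ i, ∑ k, ∑ l, (uᴴ * u) k l ⊗ₜ[ℂ] (star (u k i) * u l i) = W.Δ ((uᴴ * u) i i) := by
    intro i
    rw [hsum]
    simp only [← hΔ, ← comul_star_eq, ← W.comul_mul, ← map_sum]
    simp [Matrix.mul_apply]
  have h3 : f - uᴴ * u = 0 := by
    refine eq_zero_of_sum_tmul_star_mul_eq_zero _ u (fun c hc => ?_) (fun i => ?_)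
    · ext i
      simpa [hε, Matrix.one_apply] using congrArg W.ε (hc i)
    · rw [hz]
      simp only [Matrix.sub_apply, sub_tmul, Finset.sum_sub_distrib, h1, h2, sub_self]
  exact (sub_eq_zero.1 h3).symm

/-- A partial isometry with the comultiplication and counit of a corepresentation satisfies
`S(uᵢⱼ) = uⱼᵢ*`. -/
theorem antipode_coef (hΔ : ∀ i j, W.Δ (u i j) = ∑ k, u i k ⊗ₜ[ℂ] u k j)
    (hε : ∀ i j, W.ε (u i j) = (1 : Matrix (Fin n) (Fin n) ℂ) i j) (hu : u * uᴴ * u = u)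
    (i j : Fin n) : W.S (u i j) = star (u j i) := by
  have hv : u.map W.S = uᴴ * u.map W.εt := by
    conv_lhs => rw [← W.map_εs_mul_map_antipode hΔ, ← W.conjTranspose_mul_eq_map_εs hΔ hε hu,
      Matrix.mul_assoc, W.mul_map_antipode hΔ]
  have hvij : ∀ i j, W.S (u i j) = ∑ k, star (u k i) * W.εt (u k j) := fun i j => by
    simpa [Matrix.mul_apply] using congrFun (congrFun hv i) j
  have hc : W.Δ (W.S (u i j)) = ∑ l, W.S (u l j) ⊗ₜ[ℂ] star (u l i) := by
    have : ∀ k, W.Δ (star (u k i) * W.εt (u k j)) =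
        ∑ l, (star (u k l) * W.εt (u k j)) ⊗ₜ[ℂ] star (u l i) := by
      intro k
      rw [W.comul_mul, comul_εt, ← mul_assoc, comul_mul_one, W.comul_star_coef hΔ]
      simp [Finset.sum_mul]
    simp only [hvij, map_sum, this, sum_tmul]
    exact Finset.sum_comm
  rw [← W.counit_left (W.S (u i j)), hc]
  simp [W.counit_antipode, hε, Matrix.one_apply]

end WHA

section MatrixEntry

variable {H : Type} [NormedAddCommGroup H] [InnerProductSpace ℂ H]

/-- The matrix entry `T ⊗ a ↦ ⟨η, T ζ⟩ a` with coefficients in `N`. -/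
def matEntry (N : Type) [AddCommGroup N] [Module ℂ N] (η ζ : H) : (H →ₗ[ℂ] H) ⊗[ℂ] N →ₗ[ℂ] N :=
  (TensorProduct.lid ℂ N).toLinearMap ∘ₗ
    TensorProduct.map ((innerSL ℂ η).toLinearMap ∘ₗ LinearMap.applyₗ (R := ℂ) ζ) LinearMap.id

lemma matEntry_tmul {N : Type} [AddCommGroup N] [Module ℂ N] (η ζ : H) (T : H →ₗ[ℂ] H) (a : N) :
    matEntry N η ζ (T ⊗ₜ[ℂ] a) = inner ℂ η (T ζ) • a := by
  simp [matEntry]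

lemma matEntry_map {N P : Type} [AddCommGroup N] [Module ℂ N] [AddCommGroup P] [Module ℂ P]
    (g : N →ₗ[ℂ] P) (η ζ : H) (t : (H →ₗ[ℂ] H) ⊗[ℂ] N) :
    matEntry P η ζ (TensorProduct.map LinearMap.id g t) = g (matEntry N η ζ t) := by
  induction t with
  | zero => simp
  | tmul T a => simp [matEntry_tmul]
  | add s t hs ht => simp only [map_add, hs, ht]

lemma matEntry_mul {N : Type} [Ring N] [Algebra ℂ N] {ι : Type} [Fintype ι]
    (e : OrthonormalBasis ι ℂ H) (η ζ : H) (s t : (H →ₗ[ℂ] H) ⊗[ℂ] N) :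
    matEntry N η ζ (s * t) = ∑ k, matEntry N η (e k) s * matEntry N (e k) ζ t := by
  induction s with
  | zero => simp
  | add s s' hs hs' => simp only [add_mul, map_add, hs, hs', Finset.sum_add_distrib]
  | tmul T a =>
    induction t with
    | zero => simp
    | add t t' ht ht' => simp only [mul_add, map_add, ht, ht', Finset.sum_add_distrib]
    | tmul T' b =>
      simp only [Algebra.TensorProduct.tmul_mul_tmul, matEntry_tmul, smul_mul_smul_comm,
        ← Finset.sum_smul]
      congr 1
      conv_lhs => rw [Module.End.mul_apply, ← e.sum_repr' (T' ζ)]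
      simp [mul_comm]

lemma matEntry_star [FiniteDimensional ℂ H] {N : Type} [Ring N] [StarRing N] [Algebra ℂ N]
    [StarModule ℂ N] (η ζ : H) (t : (H →ₗ[ℂ] H) ⊗[ℂ] N) :
    matEntry N η ζ (star t) = star (matEntry N ζ η t) := by
  induction t with
  | zero => simp
  | add s t hs ht => simp only [star_add, map_add, hs, ht]
  | tmul T a =>
    simp only [star_tmul, matEntry_tmul, star_smul]
    rw [LinearMap.star_eq_adjoint, LinearMap.adjoint_inner_right]
    simp

end MatrixEntry

namespace UCorep

variable {B : Type} [NormedRing B] [StarRing B] [CStarRing B] [NormedAlgebra ℂ B]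
  [StarModule ℂ B] [FiniteDimensional ℂ B] {W : WHA B}
  {H : Type} [NormedAddCommGroup H] [InnerProductSpace ℂ H] [FiniteDimensional ℂ H]

lemma matCoef_eq (V : UCorep W H) (η ζ : H) : V.matCoef η ζ = matEntry B η ζ V.U := rfl

lemma matCoef_sum_left {ι : Type} (s : Finset ι) (V : UCorep W H) (c : ι → ℂ) (η : ι → H) (ζ : H) :
    V.matCoef (∑ i ∈ s, c i • η i) ζ = ∑ i ∈ s, star (c i) • V.matCoef (η i) ζ := by
  simp only [matCoef_eq]
  induction V.U with
  | zero => simp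
  | add s t hs ht => simp only [map_add, hs, ht, smul_add, Finset.sum_add_distrib]
  | tmul T a =>
    simp only [matEntry_tmul, sum_inner, Finset.sum_smul]
    refine Finset.sum_congr rfl fun i _ => ?_
    rw [inner_smul_left, mul_smul]
    rfl

lemma matCoef_sum_right {ι : Type} (s : Finset ι) (V : UCorep W H) (c : ι → ℂ) (η : H) (ζ : ι → H) :
    V.matCoef η (∑ i ∈ s, c i • ζ i) = ∑ i ∈ s, c i • V.matCoef η (ζ i) := by
  simp only [matCoef_eq]
  induction V.U with
  | zero => simp
  | add s t hs ht => simp only [map_add, hs, ht, smul_add, Finset.sum_add_distrib]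
  | tmul T a => simp [matEntry_tmul, Finset.sum_smul, mul_smul]

lemma inner_dualAct (V : UCorep W H) (ψ : Module.Dual ℂ B) (η ζ : H) :
    inner ℂ η (V.dualAct ψ ζ) = ψ (V.matCoef η ζ) := by
  simp only [matCoef_eq, dualAct]
  induction V.U with
  | zero => simp
  | add s t hs ht => simp only [map_add, hs, ht, LinearMap.add_apply, inner_add_right]
  | tmul T a => simp [matEntry_tmul, mul_comm]

variable (V : UCorep W H)

lemma comul_matCoef {ι : Type} [Fintype ι] (e : OrthonormalBasis ι ℂ H) (η ζ : H) :
    W.Δ (V.matCoef η ζ) = ∑ k, V.matCoef η (e k) ⊗ₜ[ℂ] V.matCoef (e k) ζ := by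
  have h := congrArg (matEntry _ η ζ) V.comul_eq
  rw [matEntry_map, matEntry_mul e] at h
  simpa [matEntry_map, matCoef_eq] using h

lemma counit_matCoef (η ζ : H) : W.ε (V.matCoef η ζ) = inner ℂ η ζ := by
  rw [← V.inner_dualAct W.ε, dualAct, V.counit_eq, LinearMap.id_apply]

/-- Matrix coefficients of a unitary corepresentation satisfy `S(U_{η,ζ}) = U_{ζ,η}*`. -/
theorem antipode_matCoef (η ζ : H) : W.S (V.matCoef η ζ) = star (V.matCoef ζ η) := by
  let e := stdOrthonormalBasis ℂ H
  let u : Matrix _ _ B := Matrix.of fun i j => V.matCoef (e i) (e j)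
  have hu : u * u.conjTranspose * u = u := by
    ext i j
    have h := congrArg (matEntry B (e i) (e j)) V.partial_isometry
    rw [tensorStar_eq_star, matEntry_mul e] at h
    simp only [matEntry_mul e, matEntry_star] at h
    simp only [Matrix.mul_apply, Matrix.conjTranspose_apply]
    exact h
  have hS := W.antipode_coef (u := u) (fun i j => V.comul_matCoef e _ _)
    (fun i j => (V.counit_matCoef _ _).trans (by
      rw [orthonormal_iff_ite.1 e.orthonormal, Matrix.one_apply])) hu
  have hS' : ∀ i j, W.S (V.matCoef (e i) (e j)) = star (V.matCoef (e j) (e i)) := hS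
  conv_lhs => rw [← e.sum_repr' η, ← e.sum_repr' ζ]
  conv_rhs => rw [← e.sum_repr' η, ← e.sum_repr' ζ]
  simp only [matCoef_sum_left, matCoef_sum_right, map_sum, map_smul, hS', star_sum, star_smul,
    star_star, Finset.smul_sum]
  rw [Finset.sum_comm]
  refine Finset.sum_congr rfl fun i _ => Finset.sum_congr rfl fun j _ => smul_comm _ _ _

/-- `U_{ψ·ζ,η}* = S((id ⊗ ψ)Δ(U_{η,ζ}))`. -/
lemma star_matCoef_dualAct (ψ : Module.Dual ℂ B) (η ζ : H) :
    star (V.matCoef (V.dualAct ψ ζ) η) = W.S ((TensorProduct.rid ℂ B)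
      (TensorProduct.map LinearMap.id ψ (W.Δ (V.matCoef η ζ)))) := by
  let e := stdOrthonormalBasis ℂ H
  rw [V.comul_matCoef e]
  conv_lhs => rw [← e.sum_repr' (V.dualAct ψ ζ), matCoef_sum_left]
  simp [inner_dualAct, star_sum, antipode_matCoef]

end UCorep

theorem matCoef_integral_in_Cs_iff {B C : Type} [NormedRing B] [StarRing B] [CStarRing B]
    [NormedAlgebra ℂ B] [StarModule ℂ B] [FiniteDimensional ℂ B]
    [NormedRing C] [StarRing C] [CStarRing C] [NormedAlgebra ℂ C] [StarModule ℂ C]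
    [FiniteDimensional ℂ C] (W : WHA B) (W' : WHA C) (h : WHAHom W W')
    (hsurj : Function.Surjective h.π)
    -- `C` is linearly spanned by the `π`-images of matrix coefficients of unitary
    -- corepresentations of `B` (on finite-dimensional Hilbert spaces)
    (hspan : Submodule.span ℂ
      {c : C | ∃ (n : ℕ) (V : UCorep W (EuclideanSpace ℂ (Fin n)))
        (η ζ : EuclideanSpace ℂ (Fin n)), c = h.π (V.matCoef η ζ)} = ⊤)
    (φ : Module.Dual ℂ C) :
    (∀ (n : ℕ) (V : UCorep W (EuclideanSpace ℂ (Fin n)))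
        (η ζ : EuclideanSpace ℂ (Fin n)),
        h.π (V.matCoef (V.dualAct (h.π.toLinearMap.dualMap φ) ζ) η) ∈ W'.Bs) ↔
      IsLeftIntegral W' φ := by
  let E : C →ₗ[ℂ] C := (TensorProduct.rid ℂ C).toLinearMap ∘ₗ
    TensorProduct.map LinearMap.id φ ∘ₗ W'.Δ
  have hE : ∀ (n : ℕ) (V : UCorep W (EuclideanSpace ℂ (Fin n))) (η ζ : EuclideanSpace ℂ (Fin n)),
      star (h.π (V.matCoef (V.dualAct (h.π.toLinearMap.dualMap φ) ζ) η)) =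
        W'.S (E (h.π (V.matCoef η ζ))) := by
    intro n V η ζ
    have hmap : ∀ t : B ⊗[ℂ] B, h.π (TensorProduct.rid ℂ B (TensorProduct.map LinearMap.id
        (h.π.toLinearMap.dualMap φ) t)) = TensorProduct.rid ℂ C (TensorProduct.map LinearMap.id φ
        (TensorProduct.map h.π.toLinearMap h.π.toLinearMap t)) := by
      intro t
      induction t with
      | zero => simp
      | tmul x y => simp
      | add s t hs ht => simp only [map_add, hs, ht]
    rw [← map_star, V.star_matCoef_dualAct, ← h.antipode_comp, hmap, ← h.comul_comp]
    rfl
  have hSstar : ∀ c, W'.S (star (W'.S c)) = star c := by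
    intro c
    have hc : c ∈ Submodule.span ℂ {c : C | ∃ (n : ℕ) (V : UCorep W (EuclideanSpace ℂ (Fin n)))
        (η ζ : EuclideanSpace ℂ (Fin n)), c = h.π (V.matCoef η ζ)} := hspan ▸ Submodule.mem_top
    induction hc using Submodule.span_induction with
    | mem c hc =>
      obtain ⟨n, V, η, ζ, rfl⟩ := hc
      rw [h.antipode_comp, V.antipode_matCoef, ← map_star, star_star, h.antipode_comp,
        V.antipode_matCoef, map_star]
    | zero => simp
    | add x y _ _ hx hy => simp only [map_add, star_add, hx, hy]
    | smul a x _ hx => simp only [map_smul, star_smul, hx]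
  have hinv : Function.Injective W'.S := fun a b hab => by
    rw [← star_inj, ← hSstar a, ← hSstar b, hab]
  have hstar : ∀ c, c ∈ W'.Bs → star c ∈ W'.Bs := by
    intro c hc
    rw [W'.mem_Bs_iff] at hc
    have hεs : star (W'.εs c) = W'.εs (star (W'.S c)) := by
      apply hinv
      rw [W'.antipode_εs, hSstar, ← W'.mul_antipode_right_eq, ← W'.mul_antipode_left_eq,
        W'.comul_star_eq]
      induction W'.Δ c with
      | zero => simp
      | tmul p q => simp [W'.antipode_mul, hSstar]
      | add p q hp hq => simp only [map_add, star_add, hp, hq]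
    rw [← hc, hεs]
    exact Submodule.subset_span ⟨_, rfl⟩
  have hint : IsLeftIntegral W' φ ↔ ∀ c, W'.S (E c) ∈ W'.Bs := by
    refine forall_congr' fun c => ?_
    have hεt : TensorProduct.rid ℂ C (TensorProduct.map W'.εtL φ (W'.Δ c)) = W'.εtL (E c) := by
      simp only [E, LinearMap.comp_apply, LinearEquiv.coe_coe]
      induction W'.Δ c with
      | zero => simp only [map_zero]
      | tmul p q => simp only [map_tmul, rid_tmul, map_smul, LinearMap.id_apply]
      | add p q hp hq => simp only [map_add, hp, hq]
    rw [hεt, W'.εtL_apply, W'.mem_Bs_iff, ← W'.antipode_εt, hinv.eq_iff]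
    exact eq_comm
  rw [hint]
  constructor
  · intro hB c
    have hle : (⊤ : Submodule ℂ C) ≤ W'.Bs.comap (W'.S ∘ₗ E) := by
      rw [← hspan, Submodule.span_le]
      rintro _ ⟨n, V, η, ζ, rfl⟩
      change W'.S (E _) ∈ W'.Bs
      rw [← hE]
      exact hstar _ (hB n V η ζ)
    exact hle Submodule.mem_top
  · intro hB n V η ζ
    rw [← star_star (h.π _), hE]
    exact hstar _ (hB _)

end
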